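/- Let q be a prime power, d ≥ 2 and n integers with n > q, and set D = d(d−1)/2 + 1. If D + 1 ≤ q ≤ 4D, then there exists an (n,q,d)-perfect hash family of size at most ⌈4(q−1)²·D·ln(q(n+1)) / (q − D)²⌉. -/

import Mathlib

open Finset in
theorem sum_pow_card_agreement {N q : ℕ} (t : ℝ) (c : Fin N → Fin q) :
    ∑ w : Fin N → Fin q, t ^ #{i | c i = w i} = (t + q - 1) ^ N := by
  have hsum : ∀ i, ∑ x : Fin q, (if c i = x then t else 1) = t + q - 1 := by
    intro i
    have h : ∀ x : Fin q, (if c i = x then t else 1) = (if c i = x then t - 1 else 0) + 1 := by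
      intro x; split_ifs <;> ring
    simp_rw [h, sum_add_distrib]
    simp
    ring
  calc ∑ w : Fin N → Fin q, t ^ #{i | c i = w i}
      = ∑ w : Fin N → Fin q, ∏ i, (if c i = w i then t else 1) := by
        refine sum_congr rfl fun w _ => ?_
        rw [prod_ite]
        simp
    _ = ∏ i, ∑ x : Fin q, (if c i = x then t else 1) := by
        rw [prod_univ_sum, Fintype.piFinset_univ]
    _ = (t + q - 1) ^ N := by simp [hsum]

open Finset in
/-- Chernoff bound on the number of words agreeing with `c` in more than `N / D` places. -/
theorem card_large_agreement_mul_rpow_le {N q D : ℕ} (hD : 0 < D) {t : ℝ} (ht : 1 ≤ t)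
    (c : Fin N → Fin q) :
    (#{w : Fin N → Fin q | N < #{i | c i = w i} * D} : ℝ) * t ^ ((N : ℝ) / D) ≤
      (t + q - 1) ^ N := by
  rw [← sum_pow_card_agreement t c, ← nsmul_eq_mul]
  refine (card_nsmul_le_sum _ (fun w : Fin N → Fin q => t ^ #{i | c i = w i}) _ ?_).trans ?_
  · intro w hw
    rw [mem_filter] at hw
    rw [← Real.rpow_natCast]
    refine Real.rpow_le_rpow_of_exponent_le ht ?_
    rw [div_le_iff₀ (by exact_mod_cast hD)]
    exact_mod_cast hw.2.le
  · refine sum_le_sum_of_subset_of_nonneg (filter_subset _ _) fun w _ _ => ?_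
    positivity

open Finset in
/-- Greedy (Gilbert–Varshamov) selection of points avoiding a sparse relation. -/
theorem exists_pairwise_not_of_mul_card_lt {W : Type*} [Fintype W] (R : W → W → Prop)
    [DecidableRel R] (hR : ∀ a b, R a b → R b a) {n B : ℕ} (hB : ∀ c, #{w | R c w} ≤ B)
    (h : n * B < Fintype.card W) :
    ∃ f : Fin n → W, ∀ i j, i ≠ j → ¬ R (f i) (f j) := by
  classical
  induction n with
  | zero => exact ⟨fun i => i.elim0, fun i => i.elim0⟩
  | succ k ih =>
    obtain ⟨f, hf⟩ := ih (lt_of_le_of_lt (Nat.mul_le_mul_right _ k.le_succ) h)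
    have hcard : #(univ.biUnion fun i : Fin k => ({w | R (f i) w} : Finset W)) <
        #(univ : Finset W) := by
      refine lt_of_le_of_lt (card_biUnion_le_card_mul _ _ B fun i _ => hB (f i)) ?_
      rw [card_univ, card_univ, Fintype.card_fin]
      exact lt_of_le_of_lt (Nat.mul_le_mul_right _ k.le_succ) h
    obtain ⟨w, -, hw⟩ := exists_mem_notMem_of_card_lt_card hcard
    simp only [mem_biUnion, mem_univ, true_and, mem_filter, not_exists] at hw
    refine ⟨Fin.cons w f, fun i j hij => ?_⟩
    cases i using Fin.cases with
    | zero =>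
      cases j using Fin.cases with
      | zero => exact absurd rfl hij
      | succ j => simpa using fun h => hw j (hR _ _ h)
    | succ i =>
      cases j using Fin.cases with
      | zero => simpa using hw i
      | succ j => simpa using hf i j fun h => hij (h ▸ rfl)

open Finset in
/-- A code whose distinct words agree in at most `N / D` places separates every set of `d` words in
some coordinate, provided `d (d - 1) < 2 D`. -/
theorem exists_coordinate_injOn {ι α : Type*} [DecidableEq ι] [DecidableEq α] {N D d : ℕ}
    (hN : 0 < N) (hD : d * (d - 1) < 2 * D) (f : ι → Fin N → α)
    (hf : ∀ x y, x ≠ y → #{i | f x i = f y i} * D ≤ N) (S : Finset ι) (hS : #S = d) :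
    ∃ i, Set.InjOn (fun x => f x i) (S : Set ι) := by
  by_contra! hcon
  have hlow : ∀ i, 2 ≤ #{p ∈ S.offDiag | f p.1 i = f p.2 i} := by
    intro i
    have hi := hcon i
    simp only [Set.InjOn, not_forall] at hi
    obtain ⟨x, hx, y, hy, hxy, hne⟩ := hi
    rw [← Nat.lt_iff_add_one_le, one_lt_card]
    refine ⟨(x, y), ?_, (y, x), ?_, fun h => hne (congrArg Prod.fst h)⟩
    · simp only [mem_filter, mem_offDiag]
      exact ⟨⟨hx, hy, hne⟩, hxy⟩
    · simp only [mem_filter, mem_offDiag]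
      exact ⟨⟨hy, hx, Ne.symm hne⟩, hxy.symm⟩
  have hcount : ∑ p ∈ S.offDiag, #{i : Fin N | f p.1 i = f p.2 i} =
      ∑ i : Fin N, #{p ∈ S.offDiag | f p.1 i = f p.2 i} :=
    sum_card_bipartiteAbove_eq_sum_card_bipartiteBelow fun (p : ι × ι) i => f p.1 i = f p.2 i
  have h1 : N * 2 ≤ ∑ i : Fin N, #{p ∈ S.offDiag | f p.1 i = f p.2 i} := by
    simpa using card_nsmul_le_sum univ _ 2 fun i _ => hlow i
  have h2 : (∑ p ∈ S.offDiag, #{i : Fin N | f p.1 i = f p.2 i}) * D ≤ d * (d - 1) * N := by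
    rw [sum_mul]
    refine (sum_le_card_nsmul _ _ N fun p hp => hf _ _ (mem_offDiag.1 hp).2.2).trans ?_
    rw [offDiag_card, hS, Nat.mul_sub_one, smul_eq_mul]
  rw [hcount] at h2
  have h3 := (Nat.mul_le_mul_right D h1).trans h2
  have h4 := Nat.mul_lt_mul_of_pos_right hD hN
  nlinarith

open Finset in
/-- A random-coding existence criterion for perfect hash families. -/
theorem exists_perfectHashFamily_of_lt {q d n D N : ℕ} (hD : d * (d - 1) < 2 * D) (hN : 0 < N)
    {t : ℝ} (ht : 1 ≤ t) (h : n * (t + q - 1) ^ N < (q : ℝ) ^ N * t ^ ((N : ℝ) / D)) :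
    ∃ H : Finset (Fin n → Fin q), #H ≤ N ∧
      ∀ S : Finset (Fin n), #S = d → ∃ h ∈ H, Set.InjOn h ↑S := by
  classical
  have hD0 : 0 < D := by omega
  have ht0 : 0 < t ^ ((N : ℝ) / D) := Real.rpow_pos_of_pos (by linarith) _
  set B : ℕ := ⌊(t + q - 1) ^ N / t ^ ((N : ℝ) / D)⌋₊ with hB
  have hnonneg : 0 ≤ (t + q - 1) ^ N :=
    pow_nonneg (by have := q.cast_nonneg (α := ℝ); linarith) _
  obtain ⟨f, hf⟩ := exists_pairwise_not_of_mul_card_lt (n := n) (B := B)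
    (fun c w : Fin N → Fin q => N < #{i | c i = w i} * D)
    (fun a b hab => by simpa only [eq_comm] using hab)
    (fun c => Nat.le_floor ((le_div_iff₀ ht0).2 (card_large_agreement_mul_rpow_le hD0 ht c)))
    (by
      have hfl : (B : ℝ) ≤ (t + q - 1) ^ N / t ^ ((N : ℝ) / D) :=
        Nat.floor_le (div_nonneg hnonneg ht0.le)
      have : (n * B : ℝ) < (q : ℝ) ^ N := by
        refine (mul_le_mul_of_nonneg_left hfl n.cast_nonneg).trans_lt ?_
        rw [← mul_div_assoc, div_lt_iff₀ ht0]
        exact h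
      rw [Fintype.card_fun, Fintype.card_fin, Fintype.card_fin]
      exact_mod_cast this)
  refine ⟨univ.image fun i x => f x i, card_image_le.trans (by simp), fun S hS => ?_⟩
  obtain ⟨i, hi⟩ := exists_coordinate_injOn hN hD f (fun x y hxy => not_lt.1 (hf x y hxy)) S hS
  exact ⟨_, mem_image_of_mem _ (mem_univ i), hi⟩

theorem Real.add_sq_div_two_le_neg_log_one_sub {x : ℝ} (hx0 : 0 ≤ x) (hx1 : x < 1) :
    x + x ^ 2 / 2 ≤ -Real.log (1 - x) := by
  have h := sum_le_hasSum (Finset.range 2) (fun i _ => by positivity)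
    (Real.hasSum_pow_div_log_of_abs_lt_one (abs_lt.2 ⟨by linarith, hx1⟩))
  norm_num [Finset.sum_range_succ] at h
  linarith

/-- The Chernoff exponent for agreement `1 / D` over an alphabet of size `q`. -/
theorem exists_chernoff_exponent_ge {q D : ℕ} (hD : 2 ≤ D) (hq : D + 1 ≤ q) :
    ∃ t : ℝ, 1 ≤ t ∧ ((q : ℝ) - D) ^ 2 / (4 * ((q : ℝ) - 1) ^ 2 * D) ≤
      Real.log t / D - Real.log ((t + q - 1) / q) := by
  have hDR : (2 : ℝ) ≤ D := by exact_mod_cast hD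
  have hqR : (D : ℝ) + 1 ≤ q := by exact_mod_cast hq
  rcases Nat.lt_or_ge q 4 with hq4 | hq4
  · obtain rfl : D = 2 := by omega
    obtain rfl : q = 3 := by omega
    refine ⟨2, by norm_num, ?_⟩
    have h1 : Real.log 2 - 2 * Real.log (4 / 3) = Real.log (9 / 8) := by
      rw [← Real.log_rpow (by norm_num), ← Real.log_div (by norm_num) (by positivity)]
      norm_num
    have h2 := Real.one_sub_inv_le_log_of_pos (x := 9 / 8) (by norm_num)
    norm_num at h2 ⊢
    linarith
  · have hq4R : (4 : ℝ) ≤ q := by exact_mod_cast hq4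
    have hD0 : (0 : ℝ) < D := by linarith
    have hq0 : (0 : ℝ) < q := by linarith
    refine ⟨q / D, (one_le_div hD0).2 (by linarith), ?_⟩
    have hlog := Real.add_sq_div_two_le_neg_log_one_sub (x := 1 - D / q)
      (sub_nonneg.2 ((div_le_one hq0).2 (by linarith))) (by linarith [div_pos hD0 hq0])
    rw [sub_sub_cancel, ← Real.log_inv, inv_div] at hlog
    have hlog2 := Real.log_le_sub_one_of_pos (x := ((q : ℝ) / D + q - 1) / q)
      (div_pos (by linarith [div_pos hq0 hD0]) hq0)
    have hdiv := div_le_div_of_nonneg_right hlog hD0.le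
    have hid : (1 - (D : ℝ) / q + (1 - (D : ℝ) / q) ^ 2 / 2) / D - (((q : ℝ) / D + q - 1) / q - 1)
        = ((q : ℝ) - D) ^ 2 / (2 * (q : ℝ) ^ 2 * D) := by
      field_simp
      ring
    have hcmp : ((q : ℝ) - D) ^ 2 / (4 * ((q : ℝ) - 1) ^ 2 * D) ≤
        ((q : ℝ) - D) ^ 2 / (2 * (q : ℝ) ^ 2 * D) := by
      gcongr _ / (?_ * _)
      nlinarith
    linarith


/-- Let `q` be a prime power, `d ≥ 2` and `n` integers with `n > q`, and set
`D = d(d−1)/2 + 1`.  If `D + 1 ≤ q ≤ 4D` then there exists an `(n,q,d)`-perfect hash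
family of size at most `⌈4(q−1)²·D·ln(q(n+1)) / (q − D)²⌉`: a family `H` of functions
`[n] → [q]` such that every subset `S ⊆ [n]` with `|S| = d` admits some `h ∈ H`
injective on `S`. -/
theorem exists_PHF_small_q (q d n : ℕ) (hq : IsPrimePow q) (hd : 2 ≤ d) (hn : n > q)
    (D : ℕ) (hD : D = d * (d - 1) / 2 + 1) (hq1 : D + 1 ≤ q) (hq2 : q ≤ 4 * D) :
    ∃ H : Finset (Fin n → Fin q),
      H.card ≤
        ⌈4 * ((q : ℝ) - 1) ^ 2 * (D : ℝ) * Real.log (q * (n + 1)) /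
          ((q : ℝ) - (D : ℝ)) ^ 2⌉₊ ∧
      ∀ S : Finset (Fin n), S.card = d → ∃ h ∈ H, Set.InjOn h ↑S := by
  have heven : d * (d - 1) / 2 * 2 = d * (d - 1) :=
    Nat.div_two_mul_two_of_even (Nat.even_mul_pred_self d)
  have hpos : 0 < d * (d - 1) := Nat.mul_pos (by omega) (by omega)
  have hD2 : 2 ≤ D := by omega
  have hDR : (2 : ℝ) ≤ D := by exact_mod_cast hD2
  have hqR : (D : ℝ) + 1 ≤ q := by exact_mod_cast hq1
  have hnR : (q : ℝ) < n := by exact_mod_cast hn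
  have hn0 : (0 : ℝ) < n := by linarith
  have hq0 : (0 : ℝ) < q := by linarith
  have hqD : (0 : ℝ) < (q : ℝ) - D := by linarith
  have hq1' : (0 : ℝ) < (q : ℝ) - 1 := by linarith
  have hloglt : Real.log n < Real.log (q * (n + 1)) :=
    Real.log_lt_log hn0 (by nlinarith)
  have hlog0 : 0 < Real.log n := Real.log_pos (by linarith)
  obtain ⟨t, ht, hexp⟩ := exists_chernoff_exponent_ge hD2 hq1
  set X : ℝ := 4 * ((q : ℝ) - 1) ^ 2 * (D : ℝ) * Real.log (q * (n + 1)) /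
    ((q : ℝ) - (D : ℝ)) ^ 2 with hX
  have hX0 : 0 < X := by
    have : 0 < Real.log (q * (n + 1)) := hlog0.trans hloglt
    positivity
  have hXN : X ≤ ⌈X⌉₊ := Nat.le_ceil X
  have hN : 0 < ⌈X⌉₊ := Nat.ceil_pos.2 hX0
  generalize ⌈X⌉₊ = N at hXN hN ⊢
  refine exists_perfectHashFamily_of_lt (D := D) (by omega) hN ht ?_
  have ht0 : 0 < t := by linarith
  have hs0 : 0 < t + q - 1 := by linarith
  rw [← Real.log_lt_log_iff (by positivity) (by positivity), Real.log_mul (by positivity)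
    (by positivity), Real.log_mul (by positivity) (by positivity), Real.log_pow, Real.log_pow,
    Real.log_rpow ht0]
  rw [Real.log_div hs0.ne' hq0.ne'] at hexp
  have hkey : Real.log (q * (n + 1)) ≤
      N * (((q : ℝ) - D) ^ 2 / (4 * ((q : ℝ) - 1) ^ 2 * D)) := by
    have hXid : X * (((q : ℝ) - D) ^ 2 / (4 * ((q : ℝ) - 1) ^ 2 * D)) =
        Real.log (q * (n + 1)) := by
      rw [hX]
      field_simp
    rw [← hXid]
    gcongr
  have hmul := mul_le_mul_of_nonneg_left hexp (N.cast_nonneg (α := ℝ))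
  have hdist : (N : ℝ) * (Real.log t / D - (Real.log (t + q - 1) - Real.log q)) =
      N / D * Real.log t - N * Real.log (t + q - 1) + N * Real.log q := by ring
  linarith
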